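/- Let 0 < p < q < ∞ and let f, g ∈ L_p + L_q on (0,∞) with f = μ(f) and g = μ(g). Suppose that for every t > 0 at least one of the following two inequalities holds: ∫_0^t g(s)^p ds ≤ ∫_0^t f(s)^p ds, or ∫_t^∞ g(s)^q ds ≤ ∫_t^∞ f(s)^q ds. Then there exist nonnegative functions g_1, g_2 ∈ L_p + L_q such that g = g_1 + g_2, g_1^p ≺≺_hd f^p and g_2^q ≺≺_tl f^q. -/

import Mathlib

open MeasureTheory ENNReal Set Filter

noncomputable section

namespace CSZ

/-- Lebesgue measure on the half line `(0,∞)`. -/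
def m0 : Measure ℝ := volume.restrict (Set.Ioi (0:ℝ))

/-- The right-continuous decreasing rearrangement `μ(t,f)` of a function on `(0,∞)`:
`μ(t,f) = inf {s ≥ 0 : m({|f| > s}) ≤ t}`. -/
def mu (f : ℝ → ℝ) (t : ℝ) : ℝ :=
  sInf {s : ℝ | 0 ≤ s ∧ m0 {x | s < |f x|} ≤ ENNReal.ofReal t}

/-- Head majorization `g ≺≺_hd f` : `∫_0^t μ(s,g) ds ≤ ∫_0^t μ(s,f) ds` for all `t > 0`. -/
def HeadMaj (g f : ℝ → ℝ) : Prop :=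
  ∀ t : ℝ, 0 < t →
    ∫⁻ s in Set.Ioc (0:ℝ) t, ENNReal.ofReal (mu g s) ≤
      ∫⁻ s in Set.Ioc (0:ℝ) t, ENNReal.ofReal (mu f s)

/-- Tail majorization `g ≺≺_tl f` : `∫_t^∞ μ(s,g) ds ≤ ∫_t^∞ μ(s,f) ds` for all `t > 0`. -/
def TailMaj (g f : ℝ → ℝ) : Prop :=
  ∀ t : ℝ, 0 < t →
    ∫⁻ s in Set.Ioi t, ENNReal.ofReal (mu g s) ≤
      ∫⁻ s in Set.Ioi t, ENNReal.ofReal (mu f s)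

/-- The space `L_p(0,∞)`, `0 < p < ∞`. -/
def LpS (p : ℝ) : Set (ℝ → ℝ) :=
  {f | Measurable f ∧ ∫⁻ x, ENNReal.ofReal (|f x| ^ p) ∂m0 < ⊤}

/-- The `L_p`-norm. -/
def LpNorm (p : ℝ) (f : ℝ → ℝ) : ℝ :=
  ((∫⁻ x, ENNReal.ofReal (|f x| ^ p) ∂m0) ^ (1/p)).toReal

/-- The space `L_∞(0,∞)`. -/
def LinftyS : Set (ℝ → ℝ) :=
  {f | Measurable f ∧ ∃ C : ℝ, ∀ᵐ x ∂m0, |f x| ≤ C}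

/-- The `L_∞`-norm (essential supremum). -/
def LinftyNorm (f : ℝ → ℝ) : ℝ :=
  (essSup (fun x => ENNReal.ofReal |f x|) m0).toReal

/-- The space `L_0(0,∞)` of measurable functions with support of finite measure. -/
def L0S : Set (ℝ → ℝ) :=
  {f | Measurable f ∧ m0 (Function.support f) < ⊤}

/-- The group "norm" on `L_0` : `‖f‖_0 = m(supp f)`. -/
def L0Norm (f : ℝ → ℝ) : ℝ := (m0 (Function.support f)).toReal

/-- The sum `X + Y` of two sets of functions. -/
def sumSet (X Y : Set (ℝ → ℝ)) : Set (ℝ → ℝ) :=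
  {f | ∃ g ∈ X, ∃ h ∈ Y, f = g + h}

/-- A quasi-Banach function space on `(0,∞)` : a linear space of measurable functions,
equipped with a complete quasi-norm, such that `f ∈ E`, `g` measurable and `|g| ≤ |f|`
imply `g ∈ E` and `‖g‖_E ≤ ‖f‖_E`. -/
structure QBFS where
  carrier : Set (ℝ → ℝ)
  qnorm : (ℝ → ℝ) → ℝ
  measurable_mem : ∀ f ∈ carrier, Measurable f
  zero_mem : (0 : ℝ → ℝ) ∈ carrier
  add_mem : ∀ f ∈ carrier, ∀ g ∈ carrier, f + g ∈ carrier
  smul_mem : ∀ (c : ℝ), ∀ f ∈ carrier, c • f ∈ carrier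
  qnorm_nonneg : ∀ f, 0 ≤ qnorm f
  qnorm_eq_zero : ∀ f ∈ carrier, qnorm f = 0 → f = 0
  qnorm_smul : ∀ (c : ℝ) (f : ℝ → ℝ), qnorm (c • f) = |c| * qnorm f
  quasi_triangle : ∃ C : ℝ, 1 ≤ C ∧ ∀ f g, qnorm (f + g) ≤ C * (qnorm f + qnorm g)
  ideal : ∀ f ∈ carrier, ∀ g : ℝ → ℝ, Measurable g →
    (∀ x, |g x| ≤ |f x|) → g ∈ carrier ∧ qnorm g ≤ qnorm f
  complete : ∀ u : ℕ → ℝ → ℝ, (∀ n, u n ∈ carrier) →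
    (∀ ε : ℝ, 0 < ε → ∃ N : ℕ, ∀ j ≥ N, ∀ k ≥ N, qnorm (u j - u k) < ε) →
    ∃ f ∈ carrier, ∀ ε : ℝ, 0 < ε → ∃ N : ℕ, ∀ n ≥ N, qnorm (u n - f) < ε

/-- `T` is linear on the subspace `S`. -/
def IsLinearOn (T : (ℝ → ℝ) → (ℝ → ℝ)) (S : Set (ℝ → ℝ)) : Prop :=
  (∀ f ∈ S, ∀ g ∈ S, T (f + g) = T f + T g) ∧
  (∀ (c : ℝ), ∀ f ∈ S, T (c • f) = c • T f)

/-- `T` maps `X` into `X` with bound `M` for the (quasi-)norm `N`. -/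
def BoundedWith (T : (ℝ → ℝ) → (ℝ → ℝ)) (X : Set (ℝ → ℝ)) (N : (ℝ → ℝ) → ℝ) (M : ℝ) :
    Prop :=
  ∀ f ∈ X, T f ∈ X ∧ N (T f) ≤ M * N f

/-- `T` maps `X` into `X` boundedly for the (quasi-)norm `N`. -/
def BoundedOn (T : (ℝ → ℝ) → (ℝ → ℝ)) (X : Set (ℝ → ℝ)) (N : (ℝ → ℝ) → ℝ) : Prop :=
  ∃ M : ℝ, 0 ≤ M ∧ BoundedWith T X N M

/-- `(E, NE)` is an interpolation space for the couple `((X,NX), (Y,NY))` :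
`X ∩ Y ⊆ E ⊆ X + Y` and every linear operator on `X + Y` which is bounded from `X` to `X`
and from `Y` to `Y` maps `E` into `E` boundedly. -/
def IsInterpolation (X Y : Set (ℝ → ℝ)) (NX NY : (ℝ → ℝ) → ℝ)
    (E : Set (ℝ → ℝ)) (NE : (ℝ → ℝ) → ℝ) : Prop :=
  X ∩ Y ⊆ E ∧ E ⊆ sumSet X Y ∧
  ∀ T : (ℝ → ℝ) → (ℝ → ℝ),
    IsLinearOn T (sumSet X Y) →
    (∀ f ∈ sumSet X Y, T f ∈ sumSet X Y) →
    BoundedOn T X NX → BoundedOn T Y NY →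
    BoundedOn T E NE

end CSZ

namespace CSZ

/-- `f` coincides with its decreasing rearrangement:
`f` is nonnegative, decreasing on `(0,∞)` and right-continuous. -/
def ShapeDR (f : ℝ → ℝ) : Prop :=
  (∀ x, 0 ≤ f x) ∧ AntitoneOn f (Set.Ioi 0) ∧
    ∀ x ∈ Set.Ioi (0:ℝ), ContinuousWithinAt f (Set.Ici x) x

end CSZ

namespace CSZ

/-- An integral over `S` is bounded by any common bound of the integrals over the lower rays
`Iio s` with `s ∈ S`. -/
lemma setLIntegral_le_of_forall_Iio {α : Type*} [LinearOrder α] [TopologicalSpace α]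
    [OrderTopology α] [SecondCountableTopology α] [MeasurableSpace α] (μ : Measure α)
    [NullSingletonClass μ] (S : Set α) (φ : α → ℝ≥0∞) (C : ℝ≥0∞)
    (h : ∀ s ∈ S, ∫⁻ x in Iio s, φ x ∂μ ≤ C) : ∫⁻ x in S, φ x ∂μ ≤ C := by
  obtain ⟨T, hTS, hTc, hTU⟩ := TopologicalSpace.isOpen_biUnion_countable S
    (fun s : α => Iio s) (fun s _ => isOpen_Iio)
  have hae : S ≤ᵐ[μ] ⋃ s : T, Iio (s : α) := by
    refine ae_le_set.2 (Set.Subsingleton.measure_zero ?_ μ)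
    rw [iUnion_coe_set, hTU]
    rintro x ⟨hx, hx'⟩ y ⟨hy, hy'⟩
    simp only [mem_iUnion, mem_Iio, not_exists, not_lt] at hx' hy'
    exact le_antisymm (hy' x hx) (hx' y hy)
  have := hTc.to_subtype
  calc ∫⁻ x in S, φ x ∂μ ≤ ∫⁻ x in ⋃ s : T, Iio (s : α), φ x ∂μ := lintegral_mono_set' hae
    _ = ⨆ s : T, ∫⁻ x in Iio (s : α), φ x ∂μ :=
        setLIntegral_iUnion_of_directed _
          (Monotone.directed_le fun s t hst => Iio_subset_Iio hst)
    _ ≤ C := iSup_le fun s => h s (hTS s.2)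

/-- An integral over `S` is bounded by any common bound of the integrals over the upper rays
`Ioi s` with `s ∈ S`. -/
lemma setLIntegral_le_of_forall_Ioi {α : Type*} [LinearOrder α] [TopologicalSpace α]
    [OrderTopology α] [SecondCountableTopology α] [mα : MeasurableSpace α] (μ : Measure α)
    [hμ : NullSingletonClass μ] (S : Set α) (φ : α → ℝ≥0∞) (C : ℝ≥0∞)
    (h : ∀ s ∈ S, ∫⁻ x in Ioi s, φ x ∂μ ≤ C) : ∫⁻ x in S, φ x ∂μ ≤ C :=
  @setLIntegral_le_of_forall_Iio αᵒᵈ _ _ _ ‹SecondCountableTopology α› mα μ hμ S φ C h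

instance : NullSingletonClass m0 := by unfold m0; infer_instance

lemma meas_lt_of_lt_mu {v : ℝ → ℝ} {r s : ℝ} (hr : 0 ≤ r) (h : r < mu v s) :
    ENNReal.ofReal s < m0 {x | r < |v x|} := by
  by_contra! hle
  exact h.not_ge (csInf_le ⟨0, fun _ hy => hy.1⟩ ⟨hr, hle⟩)

lemma mu_nonneg (v : ℝ → ℝ) (s : ℝ) : 0 ≤ mu v s :=
  Real.sInf_nonneg fun _ hy => hy.1

lemma aemeasurable_mu {v : ℝ → ℝ}
    (hv : ∀ t, 0 < t → ∃ c, 0 ≤ c ∧ m0 {x | c < |v x|} ≤ ENNReal.ofReal t) :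
    AEMeasurable (mu v) m0 :=
  aemeasurable_restrict_of_antitoneOn measurableSet_Ioi fun s hs _ _ hst =>
    csInf_le_csInf ⟨0, fun _ hy => hy.1⟩ (hv s hs)
      fun _ hy => ⟨hy.1, hy.2.trans (ENNReal.ofReal_le_ofReal hst)⟩

/-- Beyond `t`, the level sets of the rearrangement are no larger than those of the function. -/
lemma volume_lt_mu_le (v : ℝ → ℝ) {r t : ℝ} (hr : 0 ≤ r) (ht : 0 ≤ t) :
    volume.restrict (Ioi t) {s | r < mu v s} ≤ volume.restrict (Ioi t) {x | r < |v x|} := by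
  set M := m0 {x | r < |v x|} with hM
  have hM' : M ≤ volume.restrict (Ioi t) {x | r < |v x|} + ENNReal.ofReal t := by
    have hsplit : m0 = volume.restrict (Ioc 0 t) + volume.restrict (Ioi t) := by
      rw [m0, ← Ioc_union_Ioi_eq_Ioi ht,
        Measure.restrict_union (Ioc_disjoint_Ioi le_rfl) measurableSet_Ioi]
    rw [hM, hsplit, Measure.add_apply, add_comm]
    gcongr
    calc volume.restrict (Ioc 0 t) {x | r < |v x|} ≤ volume.restrict (Ioc 0 t) univ :=
          measure_mono (subset_univ _)
      _ = ENNReal.ofReal t := by simp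
  refine le_trans ?_ (tsub_le_iff_right.2 hM')
  rcases eq_or_ne M ⊤ with hT | hT
  · simp [hT]
  calc volume.restrict (Ioi t) {s | r < mu v s} ≤ volume.restrict (Ioi t) (Iio M.toReal) := by
        rw [Measure.restrict_apply' measurableSet_Ioi, Measure.restrict_apply' measurableSet_Ioi]
        refine measure_mono fun s hs => ⟨?_, hs.2⟩
        exact (ENNReal.ofReal_lt_iff_lt_toReal (ht.trans hs.2.le) hT).1
          (meas_lt_of_lt_mu hr hs.1)
    _ = M - ENNReal.ofReal t := by
        rw [Measure.restrict_apply' measurableSet_Ioi, inter_comm, Ioi_inter_Iio,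
          Real.volume_Ioo, ENNReal.ofReal_sub _ ht, ENNReal.ofReal_toReal hT]

lemma lintegral_mu_sub_le {v : ℝ → ℝ} (hvm : Measurable v)
    (hv : ∀ t, 0 < t → ∃ c, 0 ≤ c ∧ m0 {x | c < |v x|} ≤ ENNReal.ofReal t)
    {l t : ℝ} (hl : 0 ≤ l) (ht : 0 ≤ t) :
    ∫⁻ s in Ioi t, ENNReal.ofReal (mu v s - l) ≤ ∫⁻ x in Ioi t, ENNReal.ofReal (|v x| - l) := by
  have hmu : AEMeasurable (mu v) (volume.restrict (Ioi t)) :=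
    (aemeasurable_mu hv).mono_measure (Measure.restrict_mono (Ioi_subset_Ioi ht) le_rfl)
  have hmax : ∀ a : ℝ, ENNReal.ofReal a = ENNReal.ofReal (max a 0) := fun a => by
    rcases le_total a 0 with h | h <;> simp [h, ENNReal.ofReal_of_nonpos]
  simp_rw [hmax (_ - l)]
  rw [lintegral_eq_lintegral_meas_lt _ (f := fun s => max (mu v s - l) 0)
      (ae_of_all _ fun _ => le_max_right _ _) ((hmu.sub_const l).max aemeasurable_const),
    lintegral_eq_lintegral_meas_lt _ (f := fun x => max (|v x| - l) 0)
      (ae_of_all _ fun _ => le_max_right _ _) (((hvm.abs.sub_const l).max measurable_const).aemeasurable)]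
  refine setLIntegral_mono' measurableSet_Ioi fun r hr => ?_
  have hr0 : 0 < r := hr
  have key : ∀ a : ℝ, r < max (a - l) 0 ↔ r + l < a := fun a => by
    rw [lt_max_iff, or_iff_left hr0.not_gt, lt_sub_iff_add_lt]
  simp_rw [key]
  exact volume_lt_mu_le v (by positivity) ht

lemma setLIntegral_Ioc_mu_le {v : ℝ → ℝ} (hvm : Measurable v)
    (hv : ∀ t, 0 < t → ∃ c, 0 ≤ c ∧ m0 {x | c < |v x|} ≤ ENNReal.ofReal t)
    {l : ℝ} (hl : 0 ≤ l) (t : ℝ) :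
    ∫⁻ s in Ioc 0 t, ENNReal.ofReal (mu v s) ≤
      ENNReal.ofReal l * ENNReal.ofReal t + ∫⁻ x, ENNReal.ofReal (|v x| - l) ∂m0 := by
  calc ∫⁻ s in Ioc 0 t, ENNReal.ofReal (mu v s)
      ≤ ∫⁻ s in Ioc 0 t, (ENNReal.ofReal l + ENNReal.ofReal (mu v s - l)) := by
        refine lintegral_mono fun s => ?_
        simpa using ENNReal.ofReal_add_le (p := l) (q := mu v s - l)
    _ = ENNReal.ofReal l * ENNReal.ofReal t + ∫⁻ s in Ioc 0 t, ENNReal.ofReal (mu v s - l) := by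
        rw [lintegral_add_left measurable_const]; simp
    _ ≤ _ := by
        refine add_le_add_right ?_ _
        exact (lintegral_mono_set Ioc_subset_Ioi_self).trans (lintegral_mu_sub_le hvm hv hl le_rfl)

lemma meas_lt_le_of_antitoneOn {f : ℝ → ℝ} (hf : AntitoneOn f (Ioi 0)) {t : ℝ} (ht : 0 < t) :
    m0 {x | f t < f x} ≤ ENNReal.ofReal t := by
  rw [m0, Measure.restrict_apply' measurableSet_Ioi]
  calc volume ({x | f t < f x} ∩ Ioi 0) ≤ volume (Ioo 0 t) := by
        refine measure_mono fun x hx => ⟨hx.2, ?_⟩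
        by_contra! h
        exact hx.1.not_ge (hf ht hx.2 h)
    _ = ENNReal.ofReal t := by simp

lemma ShapeDR.rpow {f : ℝ → ℝ} (hf : ShapeDR f) {p : ℝ} (hp : 0 < p) :
    ShapeDR fun x => f x ^ p :=
  ⟨fun x => Real.rpow_nonneg (hf.1 x) p,
    fun _ hx _ hy hxy => Real.rpow_le_rpow (hf.1 _) (hf.2.1 hx hy hxy) hp.le,
    fun x hx => (hf.2.2 x hx).rpow_const (Or.inr hp.le)⟩

lemma ShapeDR.le_mu {f : ℝ → ℝ} (hf : ShapeDR f) {s : ℝ} (hs : 0 < s) : f s ≤ mu f s := by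
  have habs : ∀ x, |f x| = f x := fun x => abs_of_nonneg (hf.1 x)
  refine le_csInf ⟨f s, hf.1 s, ?_⟩ ?_
  · simpa only [habs] using meas_lt_le_of_antitoneOn hf.2.1 hs
  rintro r ⟨-, hr⟩
  simp only [habs] at hr
  by_contra! hlt
  obtain ⟨u, hsu, hu⟩ := (mem_nhdsGE_iff_exists_Ico_subset' (lt_add_one s)).1
    ((hf.2.2 s hs).eventually (lt_mem_nhds hlt))
  have : ENNReal.ofReal u ≤ ENNReal.ofReal s := by
    refine le_trans ?_ hr
    calc ENNReal.ofReal u = volume (Ioo 0 u) := by simp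
      _ ≤ _ := by
        rw [m0, Measure.restrict_apply' measurableSet_Ioi]
        refine measure_mono fun x hx => ⟨?_, hx.1⟩
        rcases le_total x s with h | h
        · exact hlt.trans_le (hf.2.1 hx.1 hs h)
        · exact hu ⟨h, hx.2⟩
  exact (lt_of_lt_of_le ((ENNReal.ofReal_lt_ofReal_iff (hs.trans hsu)).2 hsu) this).false

lemma exists_meas_lt_indicator_le {f : ℝ → ℝ} (hf : ShapeDR f) (A : Set ℝ) {t : ℝ}
    (ht : 0 < t) : ∃ c, 0 ≤ c ∧ m0 {x | c < |A.indicator f x|} ≤ ENNReal.ofReal t := by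
  refine ⟨f t, hf.1 t, le_trans (measure_mono fun x hx => ?_)
    (meas_lt_le_of_antitoneOn hf.2.1 ht)⟩
  rw [mem_ofPred_eq, abs_of_nonneg (indicator_nonneg (fun x _ => hf.1 x) x)] at hx
  exact lt_of_lt_of_le hx (indicator_le_self' (fun _ _ => hf.1 _) x)

/-- Restricting `g` to a set of points at which the head inequality against `f` holds yields
a function head majorized by `f`. -/
lemma headMaj_indicator {f g : ℝ → ℝ} (hf : ShapeDR f) (hg : ShapeDR g) (hgm : Measurable g)
    {A : Set ℝ} (hA : MeasurableSet A) 
    (h : ∀ t ∈ A, 0 < t → ∫⁻ s in Ioc 0 t, ENNReal.ofReal (g s) ≤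
      ∫⁻ s in Ioc 0 t, ENNReal.ofReal (f s)) :
    HeadMaj (A.indicator g) f := by
  intro t ht
  set l := f t
  have hl0 : 0 ≤ l := hf.1 t
  have hbound : ∀ s ∈ A ∩ Ioi 0 ∩ {x | l < g x}, ∫⁻ x in Iio s, ENNReal.ofReal (g x - l) ∂m0 ≤
      ∫⁻ x in Ioc 0 t, ENNReal.ofReal (f x - l) := by
    rintro s ⟨⟨hsA, hs0⟩, hsl⟩
    have h1 : ENNReal.ofReal l * ENNReal.ofReal s + ∫⁻ x in Ioc 0 s, ENNReal.ofReal (g x - l) =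
        ∫⁻ x in Ioc 0 s, ENNReal.ofReal (g x) := by
      have : ENNReal.ofReal l * ENNReal.ofReal s = ∫⁻ x in Ioc 0 s, ENNReal.ofReal l := by simp
      rw [this, ← lintegral_add_left measurable_const]
      refine setLIntegral_congr_fun measurableSet_Ioc fun x hx => ?_
      have : l < g x := lt_of_lt_of_le hsl (hg.2.1 hx.1 hs0 hx.2)
      rw [← ENNReal.ofReal_add hl0 (by linarith), add_sub_cancel]
    have h2 : ∫⁻ x in Ioc 0 s, ENNReal.ofReal (f x) ≤
        ENNReal.ofReal l * ENNReal.ofReal s + ∫⁻ x in Ioc 0 s, ENNReal.ofReal (f x - l) := by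
      have : ENNReal.ofReal l * ENNReal.ofReal s = ∫⁻ x in Ioc 0 s, ENNReal.ofReal l := by simp
      rw [this, ← lintegral_add_left measurable_const]
      refine lintegral_mono fun x => ?_
      simpa using ENNReal.ofReal_add_le (p := l) (q := f x - l)
    have h3 : ∫⁻ x in Ioc 0 s, ENNReal.ofReal (f x - l) ≤
        ∫⁻ x in Ioc 0 t, ENNReal.ofReal (f x - l) := by
      rw [← lintegral_indicator measurableSet_Ioc, ← lintegral_indicator measurableSet_Ioc]
      refine lintegral_mono fun x => indicator_le (fun y hy => ?_) x
      rcases le_total y t with hyt | hyt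
      · rw [indicator_of_mem (show y ∈ Ioc 0 t from ⟨hy.1, hyt⟩)]
      · rw [ENNReal.ofReal_of_nonpos (sub_nonpos.2 (hf.2.1 ht hy.1 hyt))]
        exact zero_le
    have h4 : ∫⁻ x in Ioc 0 s, ENNReal.ofReal (g x - l) ≤
        ∫⁻ x in Ioc 0 s, ENNReal.ofReal (f x - l) :=
      (ENNReal.add_le_add_iff_left (by finiteness)).1 (h1.trans_le ((h s hsA hs0).trans h2))
    refine le_trans ?_ (h4.trans h3)
    rw [m0, Measure.restrict_restrict measurableSet_Iio]
    exact lintegral_mono_set fun x hx => ⟨hx.2, le_of_lt hx.1⟩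
  calc ∫⁻ s in Ioc 0 t, ENNReal.ofReal (mu (A.indicator g) s)
      ≤ ENNReal.ofReal l * ENNReal.ofReal t
        + ∫⁻ x, ENNReal.ofReal (|A.indicator g x| - l) ∂m0 :=
        setLIntegral_Ioc_mu_le (hgm.indicator hA)
          (fun _ hs => exists_meas_lt_indicator_le hg A hs) hl0 t
    _ = ENNReal.ofReal l * ENNReal.ofReal t
        + ∫⁻ x in A ∩ Ioi 0 ∩ {x | l < g x}, ENNReal.ofReal (g x - l) ∂m0 := by
        congr 1
        have hB : MeasurableSet (A ∩ Ioi 0 ∩ {x | l < g x}) :=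
          (hA.inter measurableSet_Ioi).inter (measurableSet_lt measurable_const hgm)
        rw [← lintegral_indicator hB]
        refine lintegral_congr_ae ?_
        filter_upwards [ae_restrict_mem measurableSet_Ioi] with x hx
        by_cases hxA : x ∈ A
        · by_cases hxl : l < g x
          · rw [indicator_of_mem hxA, indicator_of_mem (s := A ∩ Ioi 0 ∩ {x | l < g x}) ⟨⟨hxA, hx⟩, hxl⟩,
              abs_of_nonneg (hg.1 x)]
          · rw [indicator_of_mem hxA, indicator_of_notMem fun h => hxl h.2,
              abs_of_nonneg (hg.1 x), ENNReal.ofReal_of_nonpos (by linarith)]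
        · rw [indicator_of_notMem hxA, indicator_of_notMem fun h => hxA h.1.1, abs_zero,
            ENNReal.ofReal_of_nonpos (by linarith)]
    _ ≤ ENNReal.ofReal l * ENNReal.ofReal t + ∫⁻ x in Ioc 0 t, ENNReal.ofReal (f x - l) := by
        refine add_le_add_right ?_ _
        exact setLIntegral_le_of_forall_Iio _ _ _ _ hbound
    _ = ∫⁻ x in Ioc 0 t, ENNReal.ofReal (f x) := by
        have : ENNReal.ofReal l * ENNReal.ofReal t = ∫⁻ x in Ioc 0 t, ENNReal.ofReal l := by simp
        rw [this, ← lintegral_add_left measurable_const]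
        refine setLIntegral_congr_fun measurableSet_Ioc fun x hx => ?_
        have : l ≤ f x := hf.2.1 hx.1 ht hx.2
        rw [← ENNReal.ofReal_add hl0 (by linarith), add_sub_cancel]
    _ ≤ ∫⁻ s in Ioc 0 t, ENNReal.ofReal (mu f s) :=
        setLIntegral_mono' measurableSet_Ioc fun s hs => ENNReal.ofReal_le_ofReal (hf.le_mu hs.1)

/-- Restricting `g` to a set of points at which the tail inequality against `f` holds yields
a function tail majorized by `f`. -/
lemma tailMaj_indicator {f g : ℝ → ℝ} (hf : ShapeDR f) (hg : ShapeDR g) (hgm : Measurable g)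
    {A : Set ℝ} (hA : MeasurableSet A)
    (h : ∀ t ∈ A, 0 < t → ∫⁻ s in Ioi t, ENNReal.ofReal (g s) ≤
      ∫⁻ s in Ioi t, ENNReal.ofReal (f s)) :
    TailMaj (A.indicator g) f := by
  intro t ht
  calc ∫⁻ s in Ioi t, ENNReal.ofReal (mu (A.indicator g) s)
      ≤ ∫⁻ x in Ioi t, ENNReal.ofReal |A.indicator g x| := by
        simpa using lintegral_mu_sub_le (hgm.indicator hA)
          (fun _ hs => exists_meas_lt_indicator_le hg A hs) le_rfl ht.le
    _ = ∫⁻ x in A ∩ Ioi t, ENNReal.ofReal (g x) := by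
        rw [← Measure.restrict_restrict hA, ← lintegral_indicator hA]
        refine lintegral_congr fun x => ?_
        by_cases hx : x ∈ A <;> simp [hx, abs_of_nonneg (hg.1 x)]
    _ ≤ ∫⁻ x in Ioi t, ENNReal.ofReal (f x) :=
        setLIntegral_le_of_forall_Ioi _ _ _ _ fun s hs =>
          (h s hs.1 (ht.trans hs.2)).trans (lintegral_mono_set (Ioi_subset_Ioi (le_of_lt hs.2)))
    _ ≤ ∫⁻ s in Ioi t, ENNReal.ofReal (mu f s) :=
        setLIntegral_mono' measurableSet_Ioi fun s hs =>
          ENNReal.ofReal_le_ofReal (hf.le_mu (ht.trans hs))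

lemma indicator_mem_LpS {p : ℝ} (hp : 0 < p) {f : ℝ → ℝ} (hf : f ∈ LpS p) {A : Set ℝ}
    (hA : MeasurableSet A) : A.indicator f ∈ LpS p := by
  refine ⟨hf.1.indicator hA, lt_of_le_of_lt (lintegral_mono fun x => ?_) hf.2⟩
  refine ENNReal.ofReal_le_ofReal (Real.rpow_le_rpow (abs_nonneg _) ?_ hp.le)
  by_cases hx : x ∈ A <;> simp [hx]

lemma indicator_mem_sumSet {p q : ℝ} (hp : 0 < p) (hq : 0 < q) {f : ℝ → ℝ}
    (hf : f ∈ sumSet (LpS p) (LpS q)) {A : Set ℝ} (hA : MeasurableSet A) :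
    A.indicator f ∈ sumSet (LpS p) (LpS q) := by
  obtain ⟨a, ha, b, hb, rfl⟩ := hf
  exact ⟨_, indicator_mem_LpS hp ha hA, _, indicator_mem_LpS hq hb hA, indicator_add' A a b⟩

lemma indicator_rpow {p : ℝ} (hp : 0 < p) (A : Set ℝ) (g : ℝ → ℝ) :
    (fun x => A.indicator g x ^ p) = A.indicator fun x => g x ^ p := by
  ext x
  by_cases hx : x ∈ A <;> simp [hx, Real.zero_rpow hp.ne']

end CSZ

open CSZ MeasureTheory ENNReal Set in
/-- decomposition lemma, Lemma 5.2 of the paper.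
Let `0 < p < q < ∞` and `f, g ∈ L_p + L_q` with `f = μ(f)` and `g = μ(g)`. Assume that for
every `t > 0` either `∫_0^t g^p ≤ ∫_0^t f^p` or `∫_t^∞ g^q ≤ ∫_t^∞ f^q`. Then there are
nonnegative `g₁, g₂ ∈ L_p + L_q` with `g = g₁ + g₂`, `g₁^p ≺≺_hd f^p` and
`g₂^q ≺≺_tl f^q`. -/
theorem statement17 (p q : ℝ) (hp : 0 < p) (hpq : p < q) (f g : ℝ → ℝ)
    (hf : f ∈ sumSet (LpS p) (LpS q)) (hg : g ∈ sumSet (LpS p) (LpS q))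
    (hfs : ShapeDR f) (hgs : ShapeDR g)
    (halt : ∀ t : ℝ, 0 < t →
      (∫⁻ s in Set.Ioc (0:ℝ) t, ENNReal.ofReal (g s ^ p) ≤
        ∫⁻ s in Set.Ioc (0:ℝ) t, ENNReal.ofReal (f s ^ p)) ∨
      (∫⁻ s in Set.Ioi t, ENNReal.ofReal (g s ^ q) ≤
        ∫⁻ s in Set.Ioi t, ENNReal.ofReal (f s ^ q))) :
    ∃ g₁ g₂ : ℝ → ℝ,
      (∀ x, 0 ≤ g₁ x) ∧ (∀ x, 0 ≤ g₂ x) ∧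
      g₁ ∈ sumSet (LpS p) (LpS q) ∧ g₂ ∈ sumSet (LpS p) (LpS q) ∧
      g = g₁ + g₂ ∧
      HeadMaj (fun x => g₁ x ^ p) (fun x => f x ^ p) ∧
      TailMaj (fun x => g₂ x ^ q) (fun x => f x ^ q) := by
  have hq := hp.trans hpq
  have hgm : Measurable g := by
    obtain ⟨a, ha, b, hb, rfl⟩ := hg
    exact ha.1.add hb.1
  have hmono : ∀ φ : ℝ → ℝ≥0∞, Measurable fun t => ∫⁻ s in Ioc (0 : ℝ) t, φ s := fun φ =>
    Monotone.measurable fun _ _ hst => lintegral_mono_set (Ioc_subset_Ioc_right hst)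
  set A : Set ℝ := {t | ∫⁻ s in Ioc (0 : ℝ) t, ENNReal.ofReal (g s ^ p) ≤
    ∫⁻ s in Ioc (0 : ℝ) t, ENNReal.ofReal (f s ^ p)}
  have hA : MeasurableSet A := measurableSet_le (hmono _) (hmono _)
  refine ⟨A.indicator g, Aᶜ.indicator g, indicator_nonneg fun x _ => hgs.1 x,
    indicator_nonneg fun x _ => hgs.1 x, indicator_mem_sumSet hp hq hg hA,
    indicator_mem_sumSet hp hq hg hA.compl, (indicator_self_add_compl A g).symm, ?_, ?_⟩
  · rw [indicator_rpow hp]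
    exact headMaj_indicator (hfs.rpow hp) (hgs.rpow hp) (hgm.pow_const p) hA fun t ht _ => ht
  · rw [indicator_rpow hq]
    exact tailMaj_indicator (hfs.rpow hq) (hgs.rpow hq) (hgm.pow_const q) hA.compl
      fun t ht ht0 => (halt t ht0).resolve_left ht
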